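/- Fix λ ≥ 0, a cost vector s ≥ 0 and a classical-quantum channel (ρ_x)_{x∈X}. Let p^t be a strictly positive probability distribution, p^{t+1} its Blahut–Arimoto update, and ρ^t = Σ_x p^t_x ρ_x. Then for every probability distribution p on X (with supp(Σ_x p_x ρ_x) ⊆ supp(ρ^t)): Σ_x p_x log(p^{t+1}_x / p^t_x) = −f_λ(p^{t+1}, p^t) + χ(p) − λ sᵀp + D(ρ‖ρ^t), where ρ = Σ_x p_x ρ_x. -/

import Mathlib

open Matrix Finset Filter ComplexOrder

/-- Matrix logarithm on the support: for a Hermitian matrix, apply `Real.log`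
to the eigenvalues (note `Real.log 0 = 0`, giving the logarithm on the support);
junk value `0` otherwise. -/
noncomputable def mlog {k : ℕ} (A : Matrix (Fin k) (Fin k) ℂ) : Matrix (Fin k) (Fin k) ℂ :=
  if h : A.IsHermitian then
    (h.eigenvectorUnitary : Matrix (Fin k) (Fin k) ℂ) *
      Matrix.diagonal (fun i => (Real.log (h.eigenvalues i) : ℂ)) *
      (star (h.eigenvectorUnitary : Matrix (Fin k) (Fin k) ℂ))
  else 0

/-- A density matrix: positive semidefinite with unit trace. -/
def IsDensity {k : ℕ} (ρ : Matrix (Fin k) (Fin k) ℂ) : Prop :=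
  ρ.PosSemidef ∧ ρ.trace = 1

/-- A probability distribution on `Fin k`. -/
def IsDist {k : ℕ} (p : Fin k → ℝ) : Prop :=
  (∀ x, 0 ≤ p x) ∧ ∑ x, p x = 1

/-- `supp ρ ⊆ supp σ`, expressed as `ker σ ⊆ ker ρ`. -/
def SuppLE {k : ℕ} (ρ σ : Matrix (Fin k) (Fin k) ℂ) : Prop :=
  ∀ v, σ.mulVec v = 0 → ρ.mulVec v = 0

/-- Quantum relative entropy `D(ρ‖σ) = Tr[ρ(log ρ − log σ)]` (natural log). -/
noncomputable def qRelEnt {k : ℕ} (ρ σ : Matrix (Fin k) (Fin k) ℂ) : ℝ :=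
  (Matrix.trace (ρ * (mlog ρ - mlog σ))).re

/-- Von Neumann entropy `H(ρ) = −Tr(ρ log ρ)` (natural log). -/
noncomputable def vN {k : ℕ} (ρ : Matrix (Fin k) (Fin k) ℂ) : ℝ :=
  -(Matrix.trace (ρ * mlog ρ)).re

/-- Classical relative entropy `D(p‖q)`. -/
noncomputable def cRelEnt {k : ℕ} (p q : Fin k → ℝ) : ℝ :=
  ∑ x, p x * (Real.log (p x) - Real.log (q x))

/-- Holevo quantity `χ(p) = H(Σ_x p_x ρ_x) − Σ_x p_x H(ρ_x)`. -/
noncomputable def holevo {n m : ℕ} (ρ : Fin n → Matrix (Fin m) (Fin m) ℂ)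
    (p : Fin n → ℝ) : ℝ :=
  vN (∑ x, (p x : ℂ) • ρ x) - ∑ x, p x * vN (ρ x)

/-- `f_λ(p, p') = Σ_x Tr{p_x ρ_x [log(p'_x ρ_x) − log(p_x ρ')]} − λ sᵀp`,
where `ρ' = Σ_x p'_x ρ_x`. -/
noncomputable def fBA {n m : ℕ} (ρ : Fin n → Matrix (Fin m) (Fin m) ℂ)
    (s : Fin n → ℝ) (lam : ℝ) (p p' : Fin n → ℝ) : ℝ :=
  (∑ x, (Matrix.trace (((p x : ℂ) • ρ x) *
      (mlog ((p' x : ℂ) • ρ x) - mlog ((p x : ℂ) • ∑ y, (p' y : ℂ) • ρ y)))).re)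
    - lam * ∑ x, s x * p x

/-- `r_x = exp(Tr{ρ_x[log(p_x ρ_x) − log ρ̄]} − λ s_x)` with `ρ̄ = Σ_y p_y ρ_y`. -/
noncomputable def rBA {n m : ℕ} (ρ : Fin n → Matrix (Fin m) (Fin m) ℂ)
    (s : Fin n → ℝ) (lam : ℝ) (p : Fin n → ℝ) (x : Fin n) : ℝ :=
  Real.exp ((Matrix.trace (ρ x *
      (mlog ((p x : ℂ) • ρ x) - mlog (∑ y, (p y : ℂ) • ρ y)))).re - lam * s x)

/-- One Blahut–Arimoto update step. -/
noncomputable def baStep {n m : ℕ} (ρ : Fin n → Matrix (Fin m) (Fin m) ℂ)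
    (s : Fin n → ℝ) (lam : ℝ) (p : Fin n → ℝ) (x : Fin n) : ℝ :=
  rBA ρ s lam p x / ∑ y, rBA ρ s lam p y

/-- The Blahut–Arimoto iterates starting from `p0`. -/
noncomputable def baSeq {n m : ℕ} (ρ : Fin n → Matrix (Fin m) (Fin m) ℂ)
    (s : Fin n → ℝ) (lam : ℝ) (p0 : Fin n → ℝ) : ℕ → Fin n → ℝ
  | 0 => p0
  | t + 1 => baStep ρ s lam (baSeq ρ s lam p0 t)

/-- `mlog` is the continuous functional calculus applied to `Real.log`. -/
lemma mlog_eq_cfc {k : ℕ} {A : Matrix (Fin k) (Fin k) ℂ} (hA : A.IsHermitian) :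
    mlog A = cfc Real.log A := by
  rw [hA.cfc_eq, mlog, dif_pos hA]
  rfl

lemma Matrix.continuousOn_real_spectrum {k : ℕ} (A : Matrix (Fin k) (Fin k) ℂ) (f : ℝ → ℝ) :
    ContinuousOn f (spectrum ℝ A) :=
  A.finite_real_spectrum.continuousOn f

/-- A matrix that `σ` annihilates on the right is annihilated by every `ρ` with
`supp ρ ⊆ supp σ`. -/
lemma SuppLE.mul_eq_zero {k : ℕ} {ρ σ τ : Matrix (Fin k) (Fin k) ℂ} (h : SuppLE ρ σ)
    (hτ : σ * τ = 0) : ρ * τ = 0 := by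
  refine Matrix.ext_of_mulVec_single fun i => ?_
  rw [← Matrix.mulVec_mulVec, Matrix.zero_mulVec]
  apply h
  rw [Matrix.mulVec_mulVec, hτ, Matrix.zero_mulVec]

/-- On the support of `A`, `log (c A) = log c + log A`. -/
lemma SuppLE.mul_mlog_smul {k : ℕ} {σ A : Matrix (Fin k) (Fin k) ℂ} (h : SuppLE σ A)
    (hA : A.IsHermitian) {c : ℝ} (hc : 0 < c) :
    σ * mlog ((c : ℂ) • A) = (Real.log c : ℂ) • σ + σ * mlog A := by
  have hsa : IsSelfAdjoint A := hA
  have hcA : (c : ℂ) • A = c • A := by ext; simp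
  have hcH : (c • A).IsHermitian := (IsSelfAdjoint.all c).smul hsa
  let ind : ℝ → ℝ := fun x => if x = 0 then 0 else 1
  have hlog : mlog ((c : ℂ) • A) = Real.log c • cfc ind A + mlog A := by
    rw [hcA, mlog_eq_cfc hcH, mlog_eq_cfc hA,
      ← cfc_comp_const_mul c Real.log A ((A.finite_real_spectrum.image _).continuousOn _) hsa,
      ← cfc_const_mul (Real.log c) ind A (A.continuousOn_real_spectrum _),
      ← cfc_add A _ _ (A.continuousOn_real_spectrum _) (A.continuousOn_real_spectrum _)]
    congr 1
    funext x
    by_cases hx : x = 0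
    · simp [ind, hx]
    · simp [ind, hx, Real.log_mul hc.ne' hx]
  have hAP : A * cfc ind A = A := by
    have key := cfc_mul (fun x : ℝ => x) ind A (A.continuousOn_real_spectrum _)
      (A.continuousOn_real_spectrum _)
    rw [cfc_id' ℝ A hsa] at key
    rw [← key]
    conv_rhs => rw [← cfc_id' ℝ A hsa]
    congr 1
    funext x
    by_cases hx : x = 0 <;> simp [ind, hx]
  have hσP : σ * cfc ind A = σ := by
    have := h.mul_eq_zero (τ := cfc ind A - 1) (by rw [mul_sub, hAP, mul_one, sub_self])
    rwa [mul_sub, mul_one, sub_eq_zero] at this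
  rw [hlog, mul_add, mul_smul_comm, hσP]
  congr 1

lemma SuppLE.refl {k : ℕ} (σ : Matrix (Fin k) (Fin k) ℂ) : SuppLE σ σ := fun _ => id

/-- Each state is supported below a strictly positive mixture. -/
lemma suppLE_sum_smul {n k : ℕ} {ρ : Fin n → Matrix (Fin k) (Fin k) ℂ}
    (hρ : ∀ x, (ρ x).PosSemidef) {q : Fin n → ℝ} (hq : ∀ x, 0 < q x) (x : Fin n) :
    SuppLE (ρ x) (∑ y, (q y : ℂ) • ρ y) := by
  intro v hv
  have hsum : ∑ y, (q y : ℂ) * (star v ⬝ᵥ (ρ y).mulVec v) = 0 := by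
    have := congrArg (fun w => star v ⬝ᵥ w) hv
    simpa [Matrix.sum_mulVec, Matrix.smul_mulVec, dotProduct_sum, dotProduct_smul] using this
  have hnonneg : ∀ y ∈ Finset.univ, 0 ≤ (q y : ℂ) * (star v ⬝ᵥ (ρ y).mulVec v) := fun y _ =>
    mul_nonneg (by exact_mod_cast (hq y).le) ((hρ y).dotProduct_mulVec_nonneg v)
  have hx := (Finset.sum_eq_zero_iff_of_nonneg hnonneg).1 hsum x (Finset.mem_univ x)
  have hqx : (q x : ℂ) ≠ 0 := by exact_mod_cast (hq x).ne'
  exact ((hρ x).dotProduct_mulVec_zero_iff v).1 ((mul_eq_zero.1 hx).resolve_left hqx)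

/-- Rescaling the two arguments of the logarithms in a relative entropy shifts it by the
logarithm of the ratio of the scalars. -/
lemma IsDensity.trace_mul_mlog_smul_sub {k : ℕ} {σ A : Matrix (Fin k) (Fin k) ℂ}
    (hσ : IsDensity σ) (hA : A.IsHermitian) (h : SuppLE σ A) {c d : ℝ} (hc : 0 < c)
    (hd : 0 < d) :
    (Matrix.trace (σ * (mlog ((c : ℂ) • σ) - mlog ((d : ℂ) • A)))).re =
      Real.log c - Real.log d - vN σ - (Matrix.trace (σ * mlog A)).re := by
  rw [mul_sub, (SuppLE.refl σ).mul_mlog_smul hσ.1.1 hc, h.mul_mlog_smul hA hd]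
  simp only [Matrix.trace_sub, Matrix.trace_add, Matrix.trace_smul, hσ.2, vN, smul_eq_mul,
    mul_one, Complex.sub_re, Complex.add_re, Complex.ofReal_re]
  ring

lemma isHermitian_sum_smul {n k : ℕ} {ρ : Fin n → Matrix (Fin k) (Fin k) ℂ}
    (hρ : ∀ x, (ρ x).IsHermitian) (q : Fin n → ℝ) : (∑ y, (q y : ℂ) • ρ y).IsHermitian :=
  isSelfAdjoint_sum _ fun y _ =>
    IsSelfAdjoint.smul (Complex.conj_ofReal (q y)) (hρ y).isSelfAdjoint

lemma re_trace_sum_smul_mul {n k : ℕ} (ρ : Fin n → Matrix (Fin k) (Fin k) ℂ) (p : Fin n → ℝ)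
    (B : Matrix (Fin k) (Fin k) ℂ) :
    (Matrix.trace ((∑ x, (p x : ℂ) • ρ x) * B)).re =
      ∑ x, p x * (Matrix.trace (ρ x * B)).re := by
  simp [Finset.sum_mul, Matrix.trace_sum, Complex.re_sum]

/-- The logarithmic increment of one Blahut–Arimoto step. -/
lemma log_baStep_div {n m : ℕ} {ρ : Fin n → Matrix (Fin m) (Fin m) ℂ}
    (hρ : ∀ x, IsDensity (ρ x)) (s : Fin n → ℝ) (lam : ℝ) {q : Fin n → ℝ}
    (hq : ∀ x, 0 < q x) (x : Fin n) :
    Real.log (baStep ρ s lam q x / q x) =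
      -vN (ρ x) - (Matrix.trace (ρ x * mlog (∑ y, (q y : ℂ) • ρ y))).re - lam * s x
        - Real.log (∑ y, rBA ρ s lam q y) := by
  have hr : ∀ y, 0 < rBA ρ s lam q y := fun _ => Real.exp_pos _
  have hR : 0 < ∑ y, rBA ρ s lam q y := Finset.sum_pos (fun y _ => hr y) ⟨x, Finset.mem_univ x⟩
  have hA := isHermitian_sum_smul (fun y => (hρ y).1.1) q
  have htr := (hρ x).trace_mul_mlog_smul_sub hA (suppLE_sum_smul (fun y => (hρ y).1) hq x)
    (hq x) one_pos
  rw [Complex.ofReal_one, one_smul, Real.log_one] at htr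
  rw [baStep, Real.log_div (div_pos (hr x) hR).ne' (hq x).ne', Real.log_div (hr x).ne' hR.ne',
    rBA, Real.log_exp, htr]
  ring

/-- At the updated distribution the Blahut–Arimoto functional is the log normalizer. -/
lemma fBA_baStep {n m : ℕ} [NeZero n] {ρ : Fin n → Matrix (Fin m) (Fin m) ℂ}
    (hρ : ∀ x, IsDensity (ρ x)) (s : Fin n → ℝ) (lam : ℝ) {q : Fin n → ℝ}
    (hq : ∀ x, 0 < q x) :
    fBA ρ s lam (baStep ρ s lam q) q = Real.log (∑ y, rBA ρ s lam q y) := by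
  have hr : ∀ y, 0 < rBA ρ s lam q y := fun _ => Real.exp_pos _
  have hR : 0 < ∑ y, rBA ρ s lam q y := Finset.sum_pos (fun y _ => hr y) ⟨0, Finset.mem_univ 0⟩
  have hb : ∀ x, 0 < baStep ρ s lam q x := fun x => div_pos (hr x) hR
  have hb1 : ∑ x, baStep ρ s lam q x = 1 := by
    simp only [baStep]
    rw [← Finset.sum_div, div_self hR.ne']
  have hA := isHermitian_sum_smul (fun y => (hρ y).1.1) q
  have hterm : ∀ x, (Matrix.trace (((baStep ρ s lam q x : ℂ) • ρ x) *
      (mlog ((q x : ℂ) • ρ x) -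
        mlog ((baStep ρ s lam q x : ℂ) • ∑ y, (q y : ℂ) • ρ y)))).re =
      baStep ρ s lam q x * Real.log (∑ y, rBA ρ s lam q y)
        + lam * (s x * baStep ρ s lam q x) := by
    intro x
    have hlog := log_baStep_div hρ s lam hq x
    rw [Real.log_div (hb x).ne' (hq x).ne'] at hlog
    rw [smul_mul_assoc, Matrix.trace_smul, smul_eq_mul, Complex.re_ofReal_mul,
      (hρ x).trace_mul_mlog_smul_sub hA (suppLE_sum_smul (fun y => (hρ y).1) hq x) (hq x) (hb x)]
    linear_combination -(baStep ρ s lam q x) * hlog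
  rw [fBA, Finset.sum_congr rfl fun x _ => hterm x, Finset.sum_add_distrib,
    ← Finset.sum_mul, hb1, ← Finset.mul_sum]
  ring


/-- key identity in Corollary 2: for every distribution `p` with
`supp(Σ_x p_x ρ_x) ⊆ supp(ρ^t)`,
`Σ_x p_x log(p^{t+1}_x/p^t_x) = −f_λ(p^{t+1},p^t) + χ(p) − λsᵀp + D(ρ‖ρ^t)`. -/
theorem stmt_6 {n m : ℕ} (lam : ℝ) (hlam : 0 ≤ lam)
    (s : Fin n → ℝ) (hs : ∀ x, 0 ≤ s x)
    (ρ : Fin n → Matrix (Fin m) (Fin m) ℂ) (hρ : ∀ x, IsDensity (ρ x))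
    (pt : Fin n → ℝ) (hpt : IsDist pt) (hptpos : ∀ x, 0 < pt x)
    (p : Fin n → ℝ) (hp : IsDist p)
    (hsupp : SuppLE (∑ x, (p x : ℂ) • ρ x) (∑ x, (pt x : ℂ) • ρ x)) :
    ∑ x, p x * Real.log (baStep ρ s lam pt x / pt x) =
      -(fBA ρ s lam (baStep ρ s lam pt) pt) + holevo ρ p - lam * (∑ x, s x * p x)
        + qRelEnt (∑ x, (p x : ℂ) • ρ x) (∑ x, (pt x : ℂ) • ρ x) := by
  have : NeZero n := ⟨by rintro rfl; simpa using hp.2⟩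
  rw [fBA_baStep hρ s lam hptpos, holevo, qRelEnt, vN, mul_sub, Matrix.trace_sub, Complex.sub_re,
    re_trace_sum_smul_mul ρ p (mlog (∑ x, (pt x : ℂ) • ρ x))]
  simp only [log_baStep_div hρ s lam hptpos, mul_sub, mul_neg, Finset.sum_sub_distrib,
    Finset.sum_neg_distrib]
  rw [← Finset.sum_mul, hp.2, Finset.mul_sum,
    Finset.sum_congr rfl fun x _ => (by ring : p x * (lam * s x) = lam * (s x * p x))]
  ring
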